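/- arXiv:2302.14761 — 2 statements merged into one kernel-verified Lean document; each statement's English description precedes it below -/
import Mathlib

section
/- Let n ≥ 1 and suppose the N nonzero vectors 𝒞 = (C₁,…,C_N) in V satisfy the incidence conditions (I.1), (I.2), (I.3). Then the function w(·;𝒞) is constant on the set V_{<0} of negative vectors: for all v, w ∈ V with B(v,v) < 0 and B(w,w) < 0, one has w(v;𝒞) = w(w;𝒞). -/
/-- The bilinear form of signature (n,2) on ℝ^(n+2): first two coordinates negative. -/
noncomputable def B (n : ℕ) (x y : Fin (n + 2) → ℝ) : ℝ :=
  ∑ i : Fin (n + 2), (if (i : ℕ) < 2 then -1 else 1) * (x i * y i)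

/-- w(x;𝒞) = ∑_j sgn(B(x,C_j)) sgn(B(x,C_{j+1})), with cyclic indexing. -/
noncomputable def wt (n N : ℕ) [NeZero N] (C : Fin N → (Fin (n + 2) → ℝ))
    (x : Fin (n + 2) → ℝ) : ℝ :=
  ∑ j : Fin N, Real.sign (B n x (C j)) * Real.sign (B n x (C (j + 1)))

/-- Incidence condition (I.1). -/
def I1 (n N : ℕ) (C : Fin N → (Fin (n + 2) → ℝ)) : Prop :=
  ∀ j, B n (C j) (C j) ≤ 0

/-- Incidence condition (I.2). -/
def I2 (n N : ℕ) [NeZero N] (C : Fin N → (Fin (n + 2) → ℝ)) : Prop :=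
  ∀ j : Fin N,
    (B n (C j) (C j) * B n (C (j + 1)) (C (j + 1)) > 0 →
      B n (C j) (C j) * B n (C (j + 1)) (C (j + 1)) - (B n (C j) (C (j + 1))) ^ 2 > 0) ∧
    (B n (C j) (C j) * B n (C (j + 1)) (C (j + 1)) = 0 →
      B n (C j) (C j) * B n (C (j + 1)) (C (j + 1)) - (B n (C j) (C (j + 1))) ^ 2 = 0)

/-- Incidence condition (I.3). -/
def I3 (n N : ℕ) [NeZero N] (C : Fin N → (Fin (n + 2) → ℝ)) : Prop :=
  ∀ j : Fin N,
    (B n (C j) (C j) < 0 →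
      B n (C j) (C j) * B n (C (j - 1)) (C (j + 1)) -
        B n (C j) (C (j - 1)) * B n (C j) (C (j + 1)) < 0) ∧
    (B n (C j) (C j) = 0 → B n (C (j - 1)) (C (j + 1)) > 0)

open Filter Topology

section BilinearForm

variable {n : ℕ}

lemma B_comm (x y : Fin (n + 2) → ℝ) : B n x y = B n y x := by
  simp only [B, mul_comm (x _)]

lemma B_add_left (x y z : Fin (n + 2) → ℝ) : B n (x + y) z = B n x z + B n y z := by
  simp only [B, ← Finset.sum_add_distrib, Pi.add_apply]
  exact Finset.sum_congr rfl fun i _ => by ring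

lemma B_smul_left (a : ℝ) (x z : Fin (n + 2) → ℝ) : B n (a • x) z = a * B n x z := by
  simp only [B, Finset.mul_sum, Pi.smul_apply, smul_eq_mul]
  exact Finset.sum_congr rfl fun i _ => by ring

lemma B_add_right (x y z : Fin (n + 2) → ℝ) : B n z (x + y) = B n z x + B n z y := by
  rw [B_comm, B_add_left, B_comm x, B_comm y]

lemma B_smul_right (a : ℝ) (x z : Fin (n + 2) → ℝ) : B n z (a • x) = a * B n z x := by
  rw [B_comm, B_smul_left, B_comm x]

lemma continuous_B_left (z : Fin (n + 2) → ℝ) : Continuous fun x => B n x z := by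
  unfold B
  fun_prop

lemma B_self_eq (x : Fin (n + 2) → ℝ) :
    B n x x = -(x 0 * x 0) - x 1 * x 1 + ∑ i : Fin n, x i.succ.succ * x i.succ.succ := by
  simp [B, Fin.sum_univ_succ]
  ring

/-- A vector of the positive definite coordinate subspace with `B y y ≤ 0` is zero. -/
lemma eq_zero_of_B_self_nonpos {y : Fin (n + 2) → ℝ} (h0 : y 0 = 0) (h1 : y 1 = 0)
    (h : B n y y ≤ 0) : y = 0 := by
  rw [B_self_eq, h0, h1] at h
  have hnn : ∀ i ∈ Finset.univ, 0 ≤ (fun i : Fin n => y i.succ.succ * y i.succ.succ) i :=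
    fun i _ => mul_self_nonneg _
  have hs := (Finset.sum_eq_zero_iff_of_nonneg hnn).1
    (le_antisymm (by linarith) (Finset.sum_nonneg hnn))
  funext i
  refine Fin.cases h0 (fun i => Fin.cases h1 (fun i => ?_) i) i
  exact mul_self_eq_zero.1 (hs i (Finset.mem_univ i))

/-- The form is positive semidefinite on the orthogonal complement of a negative vector and a
nonzero nonpositive vector orthogonal to it. -/
lemma B_self_nonneg_of_orthogonal {x c u : Fin (n + 2) → ℝ} (hx : B n x x < 0)
    (hc : B n c c ≤ 0) (hc0 : c ≠ 0) (hxc : B n x c = 0) (hxu : B n x u = 0)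
    (hcu : B n c u = 0) : 0 ≤ B n u u := by
  by_contra! hu
  let f : (Fin 3 → ℝ) →ₗ[ℝ] (Fin 2 → ℝ) :=
    Matrix.toLin' !![x 0, c 0, u 0; x 1, c 1, u 1]
  obtain ⟨p, hp, hp0⟩ := (Submodule.ne_bot_iff _).1
    (LinearMap.ker_ne_bot_of_finrank_lt (f := f) (by simp))
  have hp' : f p = 0 := hp
  have e0 := congrFun hp' 0
  have e1 := congrFun hp' 1
  simp [f, Matrix.vecHead, Matrix.vecTail] at e0 e1
  have hB : B n (p 0 • x + p 1 • c + p 2 • u) (p 0 • x + p 1 • c + p 2 • u) =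
      p 0 ^ 2 * B n x x + p 1 ^ 2 * B n c c + p 2 ^ 2 * B n u u := by
    simp only [B_add_left, B_add_right, B_smul_left, B_smul_right, B_comm c x, B_comm u x,
      B_comm u c, hxc, hxu, hcu]
    ring
  have hx' := mul_nonneg (sq_nonneg (p 0)) (neg_nonneg.2 hx.le)
  have hc' := mul_nonneg (sq_nonneg (p 1)) (neg_nonneg.2 hc)
  have hu' := mul_nonneg (sq_nonneg (p 2)) (neg_nonneg.2 hu.le)
  have hy : p 0 • x + p 1 • c + p 2 • u = 0 := by
    apply eq_zero_of_B_self_nonpos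
    · simp; linarith
    · simp; linarith
    · rw [hB]; linarith
  have hz : B n (p 0 • x + p 1 • c + p 2 • u) (p 0 • x + p 1 • c + p 2 • u) = 0 := by
    rw [hy]; simp [B]
  rw [hB] at hz
  have p0 : p 0 = 0 := by
    have : p 0 ^ 2 * B n x x = 0 := by linarith
    simpa [hx.ne] using this
  have p2 : p 2 = 0 := by
    have : p 2 ^ 2 * B n u u = 0 := by linarith
    simpa [hu.ne] using this
  have p1 : p 1 = 0 := by simpa [p0, p2, hc0] using hy
  exact hp0 (by funext i; fin_cases i <;> assumption)

/-- Cauchy–Schwarz on the orthogonal complement of a negative vector and a nonzero nonpositive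
vector orthogonal to it. -/
lemma B_sq_le_of_orthogonal {x c u v : Fin (n + 2) → ℝ} (hx : B n x x < 0)
    (hc : B n c c ≤ 0) (hc0 : c ≠ 0) (hxc : B n x c = 0) (hxu : B n x u = 0)
    (hcu : B n c u = 0) (hxv : B n x v = 0) (hcv : B n c v = 0) :
    B n u v ^ 2 ≤ B n u u * B n v v := by
  have key : ∀ t : ℝ, 0 ≤ B n u u * (t * t) + 2 * B n u v * t + B n v v := fun t => by
    have := B_self_nonneg_of_orthogonal (u := t • u + v) hx hc hc0 hxc
      (by simp [B_add_right, B_smul_right, hxu, hxv])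
      (by simp [B_add_right, B_smul_right, hcu, hcv])
    simp only [B_add_left, B_add_right, B_smul_left, B_smul_right, B_comm v u] at this
    linarith
  have := discrim_le_zero key
  rw [discrim] at this
  linarith

/-- In the orthogonal complement of a nonzero nonpositive vector `c`, nonpositive vectors with
positive product lie on opposite sides of the hyperplane orthogonal to a negative vector. -/
lemma B_mul_B_neg_of_orthogonal {x c a b : Fin (n + 2) → ℝ} (hx : B n x x < 0)
    (hc : B n c c ≤ 0) (hc0 : c ≠ 0) (hxc : B n x c = 0) (hca : B n c a = 0)
    (hcb : B n c b = 0) (ha : B n a a ≤ 0) (hb : B n b b ≤ 0) (hab : 0 < B n a b) :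
    B n x a * B n x b < 0 := by
  have orth : ∀ z, B n x (B n x x • z + (-B n x z) • x) = 0 := fun z => by
    simp only [B_add_right, B_smul_right]; ring
  have orthc : ∀ z, B n c z = 0 → B n c (B n x x • z + (-B n x z) • x) = 0 := fun z hz => by
    rw [B_add_right, B_smul_right, B_smul_right, hz, B_comm c x, hxc]; ring
  have expand : ∀ y z, B n (B n x x • y + (-B n x y) • x) (B n x x • z + (-B n x z) • x) =
      B n x x * (B n x x * B n y z - B n x y * B n x z) := fun y z => by
    simp only [B_add_left, B_add_right, B_smul_left, B_smul_right, B_comm y x]; ring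
  have hU := B_self_nonneg_of_orthogonal hx hc hc0 hxc (orth a) (orthc a hca)
  have hV := B_self_nonneg_of_orthogonal hx hc hc0 hxc (orth b) (orthc b hcb)
  have hCS := B_sq_le_of_orthogonal hx hc hc0 hxc (orth a) (orthc a hca) (orth b) (orthc b hcb)
  simp only [expand] at hU hV hCS
  by_contra! hneg
  have hU' : B n x x * B n a a - B n x a * B n x a ≤ 0 := nonpos_of_mul_nonneg_right hU hx
  have hV' : B n x x * B n b b - B n x b * B n x b ≤ 0 := nonpos_of_mul_nonneg_right hV hx
  have hCS' : (B n x x * B n a b - B n x a * B n x b) ^ 2 ≤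
      (B n x a * B n x a - B n x x * B n a a) * (B n x b * B n x b - B n x x * B n b b) := by
    refine le_of_mul_le_mul_left ?_ (pow_pos (neg_pos.2 hx) 2)
    linarith
  have hbound : (B n x a * B n x a - B n x x * B n a a) *
      (B n x b * B n x b - B n x x * B n b b) ≤ (B n x a * B n x a) * (B n x b * B n x b) := by
    have h1 := mul_nonneg_of_nonpos_of_nonpos hx.le ha
    have h2 := mul_nonneg_of_nonpos_of_nonpos hx.le hb
    apply mul_le_mul <;> nlinarith [mul_self_nonneg (B n x a)]
  have hxab := mul_neg_of_neg_of_pos hx hab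
  nlinarith

end BilinearForm

section Incidence

variable {n N : ℕ} [NeZero N] {C : Fin N → (Fin (n + 2) → ℝ)}

/-- If a negative vector is orthogonal to `C j`, then the two neighbours of `C j` lie strictly on
opposite sides of the orthogonal hyperplane. -/
lemma B_mul_B_neg_of_incidence (hC : ∀ j, C j ≠ 0) (h1 : I1 n N C) (h2 : I2 n N C)
    (h3 : I3 n N C) {x : Fin (n + 2) → ℝ} (hx : B n x x < 0) {j : Fin N}
    (hj : B n x (C j) = 0) : B n x (C (j - 1)) * B n x (C (j + 1)) < 0 := by
  have adj : ∀ k, (k = j - 1 ∨ k = j + 1) →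
      (B n (C j) (C j) * B n (C k) (C k) > 0 →
        B n (C j) (C j) * B n (C k) (C k) - B n (C j) (C k) ^ 2 > 0) ∧
      (B n (C j) (C j) * B n (C k) (C k) = 0 →
        B n (C j) (C j) * B n (C k) (C k) - B n (C j) (C k) ^ 2 = 0) := by
    rintro k (rfl | rfl)
    · have := h2 (j - 1)
      rwa [sub_add_cancel, B_comm (C (j - 1)) (C j), mul_comm (B n (C (j - 1)) _)] at this
    · exact h2 j
  rcases (h1 j).lt_or_eq with hneg | hnull
  · set q := B n (C j) (C j) with hq
    have gram : ∀ k, (k = j - 1 ∨ k = j + 1) →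
        0 ≤ q * B n (C k) (C k) - B n (C j) (C k) ^ 2 := fun k hk => by
      rcases (mul_nonneg_of_nonpos_of_nonpos hneg.le (h1 k)).lt_or_eq with h | h
      · exact ((adj k hk).1 h).le
      · exact ((adj k hk).2 h.symm).ge
    have expand : ∀ k l, B n (q • C k + (-B n (C j) (C k)) • C j)
        (q • C l + (-B n (C j) (C l)) • C j) =
        q * (q * B n (C k) (C l) - B n (C j) (C k) * B n (C j) (C l)) := fun k l => by
      simp only [B_add_left, B_add_right, B_smul_left, B_smul_right, B_comm (C k) (C j), ← hq]
      ring
    have orth : ∀ k, B n (C j) (q • C k + (-B n (C j) (C k)) • C j) = 0 := fun k => by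
      simp only [B_add_right, B_smul_right, ← hq]; ring
    have hproj : ∀ k, B n x (q • C k + (-B n (C j) (C k)) • C j) = q * B n x (C k) := fun k => by
      rw [B_add_right, B_smul_right, B_smul_right, hj]; ring
    have nonpos : ∀ k, (k = j - 1 ∨ k = j + 1) → B n (q • C k + (-B n (C j) (C k)) • C j)
        (q • C k + (-B n (C j) (C k)) • C j) ≤ 0 := fun k hk => by
      rw [expand, ← sq]
      exact mul_nonpos_of_nonpos_of_nonneg hneg.le (gram k hk)
    have := B_mul_B_neg_of_orthogonal hx hneg.le (hC j) hj (orth (j - 1)) (orth (j + 1))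
      (nonpos _ (.inl rfl)) (nonpos _ (.inr rfl))
      (by rw [expand]; exact mul_pos_of_neg_of_neg hneg ((h3 j).1 hneg))
    rw [hproj, hproj] at this
    have hq2 := mul_pos_of_neg_of_neg hneg hneg
    by_contra! hcon
    nlinarith [mul_nonneg hq2.le hcon]
  · have orth : ∀ k, (k = j - 1 ∨ k = j + 1) → B n (C j) (C k) = 0 := fun k hk => by
      simpa [hnull] using (adj k hk).2
    exact B_mul_B_neg_of_orthogonal hx (h1 j) (hC j) hj (orth _ (.inl rfl)) (orth _ (.inr rfl))
      (h1 _) (h1 _) ((h3 j).2 hnull)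

end Incidence

lemma sign_add_sign_eq_zero_of_mul_neg {a b : ℝ} (h : a * b < 0) :
    Real.sign a + Real.sign b = 0 := by
  rcases mul_neg_iff.1 h with ⟨ha, hb⟩ | ⟨ha, hb⟩
  · simp [Real.sign_of_pos ha, Real.sign_of_neg hb]
  · simp [Real.sign_of_neg ha, Real.sign_of_pos hb]

/-- A cyclic sum of products of neighbours does not change when entries whose neighbours are
nonzero and opposite are altered at places where the sequence vanishes. -/
lemma cyclic_sum_mul_eq {N : ℕ} [NeZero N] {s t : Fin N → ℝ} (hst : ∀ j, s j ≠ 0 → t j = s j)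
    (hopp : ∀ j, s j = 0 → s (j - 1) + s (j + 1) = 0) (hne : ∀ j, s j = 0 → s (j + 1) ≠ 0) :
    ∑ j, t j * t (j + 1) = ∑ j, s j * s (j + 1) := by
  have hterm : ∀ j, t j * t (j + 1) = s j * s (j + 1) + (t j - s j) * s (j + 1) +
      s j * (t (j + 1) - s (j + 1)) := fun j => by
    have : (t j - s j) * (t (j + 1) - s (j + 1)) = 0 := by
      by_cases h : s j = 0
      · rw [hst _ (hne j h)]; ring
      · rw [hst _ h]; ring
    linarith
  have hshift : ∑ j, s j * (t (j + 1) - s (j + 1)) = ∑ j, s (j - 1) * (t j - s j) :=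
    Fintype.sum_equiv (Equiv.addRight 1) _ _ fun j => by simp
  simp only [hterm, Finset.sum_add_distrib, hshift]
  rw [add_assoc, ← Finset.sum_add_distrib, add_eq_left]
  refine Finset.sum_eq_zero fun j _ => ?_
  by_cases h : s j = 0
  · linear_combination (t j - s j) * hopp j h
  · rw [hst j h]; ring

lemma eventually_sign_eq {a : ℝ} (ha : a ≠ 0) : ∀ᶠ b in 𝓝 a, Real.sign b = Real.sign a := by
  rcases ha.lt_or_gt with h | h
  · filter_upwards [gt_mem_nhds h] with b hb
    rw [Real.sign_of_neg h, Real.sign_of_neg hb]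
  · filter_upwards [lt_mem_nhds h] with b hb
    rw [Real.sign_of_pos h, Real.sign_of_pos hb]

/-- The function `wt` is locally constant at negative vectors. -/
lemma eventually_wt_eq {n N : ℕ} [NeZero N] {C : Fin N → (Fin (n + 2) → ℝ)} (hC : ∀ j, C j ≠ 0)
    (h1 : I1 n N C) (h2 : I2 n N C) (h3 : I3 n N C) {x : Fin (n + 2) → ℝ} (hx : B n x x < 0) :
    ∀ᶠ y in 𝓝 x, wt n N C y = wt n N C x := by
  have hsign : ∀ᶠ y in 𝓝 x, ∀ j, B n x (C j) ≠ 0 →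
      Real.sign (B n y (C j)) = Real.sign (B n x (C j)) := by
    refine eventually_all.2 fun j => ?_
    by_cases h : B n x (C j) = 0
    · simp [h]
    · filter_upwards [(continuous_B_left (C j)).continuousAt.eventually (eventually_sign_eq h)]
        with y hy _ using hy
  filter_upwards [hsign] with y hy
  have hopp : ∀ j, Real.sign (B n x (C j)) = 0 → B n x (C (j - 1)) * B n x (C (j + 1)) < 0 :=
    fun j hj => B_mul_B_neg_of_incidence hC h1 h2 h3 hx (Real.sign_eq_zero_iff.1 hj)
  refine cyclic_sum_mul_eq (s := fun j => Real.sign (B n x (C j)))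
    (t := fun j => Real.sign (B n y (C j))) (fun j hj => hy j (mt Real.sign_eq_zero_iff.2 hj))
    (fun j hj => sign_add_sign_eq_zero_of_mul_neg (hopp j hj)) (fun j hj h => ?_)
  have := hopp j hj
  rw [Real.sign_eq_zero_iff.1 h, mul_zero] at this
  exact this.false

lemma wt_neg {n N : ℕ} [NeZero N] (C : Fin N → (Fin (n + 2) → ℝ)) (x : Fin (n + 2) → ℝ) :
    wt n N C (-x) = wt n N C x := by
  have hB : ∀ z, B n (-x) z = -B n x z := fun z => by
    rw [← neg_one_smul ℝ x, B_smul_left]; ring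
  simp [wt, hB, Real.sign_neg]

/-- The segment between two negative vectors with nonpositive product is negative. -/
lemma B_self_neg_of_mem_segment {n : ℕ} {v w z : Fin (n + 2) → ℝ} (hv : B n v v < 0)
    (hw : B n w w < 0) (hvw : B n v w ≤ 0) (hz : z ∈ segment ℝ v w) : B n z z < 0 := by
  obtain ⟨a, b, ha, hb, hab, rfl⟩ := hz
  simp only [B_add_left, B_add_right, B_smul_left, B_smul_right, B_comm w v]
  have hcross := mul_nonneg (mul_nonneg ha hb) (neg_nonneg.2 hvw)
  rcases ha.lt_or_eq with ha' | rfl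
  · nlinarith [mul_pos (mul_pos ha' ha') (neg_pos.2 hv),
      mul_nonneg (mul_nonneg hb hb) (neg_nonneg.2 hw.le)]
  · obtain rfl : b = 1 := by linarith
    simpa using hw

lemma wt_eq_of_B_nonpos {n N : ℕ} [NeZero N] {C : Fin N → (Fin (n + 2) → ℝ)}
    (hC : ∀ j, C j ≠ 0) (h1 : I1 n N C) (h2 : I2 n N C) (h3 : I3 n N C)
    {v w : Fin (n + 2) → ℝ} (hv : B n v v < 0) (hw : B n w w < 0) (hvw : B n v w ≤ 0) :
    wt n N C v = wt n N C w :=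
  (convex_segment v w).isPreconnected.induction₂ (fun x y => wt n N C x = wt n N C y)
    (fun _ hx => nhdsWithin_le_nhds <|
      (eventually_wt_eq hC h1 h2 h3 (B_self_neg_of_mem_segment hv hw hvw hx)).mono
        fun _ h => h.symm)
    (fun _ _ _ _ _ _ => Eq.trans) (fun _ _ _ _ => Eq.symm)
    (left_mem_segment ℝ v w) (right_mem_segment ℝ v w)

/-- under (I.1)-(I.3), w(·;𝒞) is constant on the set of negative vectors. -/
theorem w_constant_on_negative_vectors (n N : ℕ) (hn : 1 ≤ n) [NeZero N]
    (C : Fin N → (Fin (n + 2) → ℝ)) (hC : ∀ j, C j ≠ 0)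
    (h1 : I1 n N C) (h2 : I2 n N C) (h3 : I3 n N C) :
    ∀ v w : Fin (n + 2) → ℝ, B n v v < 0 → B n w w < 0 →
      wt n N C v = wt n N C w := by
  intro v w hv hw
  rcases le_total (B n v w) 0 with h | h
  · exact wt_eq_of_B_nonpos hC h1 h2 h3 hv hw h
  · rw [← wt_neg C w]
    apply wt_eq_of_B_nonpos hC h1 h2 h3 hv <;> rw [← neg_one_smul ℝ w]
    · rw [B_smul_left, B_smul_right]; linarith
    · rw [B_smul_right]; linarith
end

section
/- Let n ≥ 1 and let 𝒞 = (C₁,…,C_N) be N nonzero vectors in V satisfying the incidence conditions (I.1) and (I.2). Then for every j ∈ {1,…,N} and every s ∈ [0,1], the vector γ_j(s) = (1−s)·C_j + s·C_{j+1} is non-positive, i.e., B(γ_j(s), γ_j(s)) ≤ 0. -/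
/-- Expansion of the quadratic form of a linear combination. -/
theorem B_smul_add_smul_self (n : ℕ) (p s : ℝ) (x y : Fin (n + 2) → ℝ) :
    B n (p • x + s • y) (p • x + s • y) =
      p ^ 2 * B n x x + 2 * p * s * B n x y + s ^ 2 * B n y y := by
  simp only [B, Finset.mul_sum, ← Finset.sum_add_distrib]
  refine Finset.sum_congr rfl fun i _ => ?_
  simp only [Pi.add_apply, Pi.smul_apply, smul_eq_mul]
  ring

/-- A binary quadratic form with non-positive diagonal and non-negative determinant
is negative semidefinite. -/
theorem binary_form_nonpos {a b c : ℝ} (ha : a ≤ 0) (hc : c ≤ 0) (hdet : b ^ 2 ≤ a * c)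
    (p s : ℝ) : p ^ 2 * a + 2 * p * s * b + s ^ 2 * c ≤ 0 := by
  rcases ha.eq_or_lt with rfl | ha
  · have hb : b = 0 := by
      rw [zero_mul] at hdet
      exact pow_eq_zero_iff two_ne_zero |>.mp (le_antisymm hdet (sq_nonneg b))
    subst hb
    nlinarith [mul_nonneg (sq_nonneg s) (neg_nonneg.mpr hc)]
  · refine nonpos_of_mul_nonneg_right (a := a) ?_ ha
    nlinarith [sq_nonneg (p * a + s * b), mul_nonneg (sq_nonneg s) (sub_nonneg.mpr hdet)]

/-- under (I.1) and (I.2), every point of the segment from C_j to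
C_{j+1} is a non-positive vector. -/
theorem segment_nonpositive (n N : ℕ) (hn : 1 ≤ n) [NeZero N]
    (C : Fin N → (Fin (n + 2) → ℝ)) (hC : ∀ j, C j ≠ 0)
    (h1 : I1 n N C) (h2 : I2 n N C)
    (j : Fin N) (s : ℝ) (hs : s ∈ Set.Icc (0 : ℝ) 1) :
    B n ((1 - s) • C j + s • C (j + 1)) ((1 - s) • C j + s • C (j + 1)) ≤ 0 := by
  rw [B_smul_add_smul_self]
  refine binary_form_nonpos (h1 j) (h1 (j + 1)) ?_ _ _
  rcases (mul_nonneg_of_nonpos_of_nonpos (h1 j) (h1 (j + 1))).eq_or_lt with h | h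
  · linarith [(h2 j).2 h.symm]
  · linarith [(h2 j).1 h]
end
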